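/- For the vertex with outgoing partitions \mu^1=(1), \mu^2=(2), \mu^3=(1), weighted box counting of T-invariant submodule components Q of M/O_C (with weight \chi_{top}(Q) and box-length grading) gives: there is 1 component of length 0 with Euler characteristic 1; components of length 1 contribute total Euler characteristic 2; length 2 contributes 4; length 3 contributes 7. Hence the generating function \sum_{[Q]} \chi_{top}(Q)(-q)^{\ell(Q)} = 1 + 2(-q) + 4(-q)^2 + 7(-q)^3 + O(q^4). -/

import Mathlib

/-!
Shared combinatorial model of the T-module `M/O_{C_μ}`:
for each weight `w ∈ ℤ³`, the fiber of `M` at `w` has one basis vector for each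
coordinate cylinder `Cyl_i` (determined by the partitions `μ i`) containing `w`, and
`O_C ⊆ M` is generated by `(1,1,1)`.
-/

open scoped Classical

noncomputable section

/-- The weight lattice `ℤ³`. -/
abbrev W3 := Fin 3 → ℤ

/-- The standard basis vector `e_j`. -/
def eW (j : Fin 3) : W3 := fun i => if i = j then 1 else 0

variable (μ : Fin 3 → YoungDiagram)

/-- `w` lies in the cylinder `Cyl_i` along the `x_i`-axis with cross-section `μ i`. -/
def inCyl (i : Fin 3) (w : W3) : Prop :=
  0 ≤ w (i + 1) ∧ 0 ≤ w (i + 2) ∧ ((w (i + 1)).toNat, (w (i + 2)).toNat) ∈ μ i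

/-- The fiber of `M` at weight `w`: one copy of `ℂ` for each cylinder containing `w`. -/
abbrev VF (w : W3) : Type := {i : Fin 3 // inCyl μ i w} → ℂ

/-- Number of cylinders containing `w`. -/
def numCyl (w : W3) : ℕ := Nat.card {i : Fin 3 // inCyl μ i w}

/-- `w` has all coordinates nonnegative. -/
def nonnegW (w : W3) : Prop := ∀ i, 0 ≤ w i

/-- The vector `(1,1,1)_w`. -/
def constV (w : W3) : VF μ w := fun _ => 1

/-- The fiber of `O_C ⊆ M` at weight `w`: the line spanned by `(1,1,1)_w` for
nonnegative `w`, and `0` otherwise. -/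
def ocSub (w : W3) : Submodule ℂ (VF μ w) :=
  if nonnegW w then Submodule.span ℂ {constV μ w} else ⊥

/-- Multiplication by `x_j` on fibers, `M_w → M_{w+e_j}`: the component in `Cyl_i`
survives exactly when both `w` and `w + e_j` lie in `Cyl_i`. -/
def mapV (j : Fin 3) (w : W3) : VF μ w →ₗ[ℂ] VF μ (w + eW j) where
  toFun f k := if h : inCyl μ k.1 w then f ⟨k.1, h⟩ else 0
  map_add' f g := by
    funext k; by_cases h : inCyl μ k.1 w <;> simp [h]
  map_smul' c f := by
    funext k; by_cases h : inCyl μ k.1 w <;> simp [h]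

/-- A family of subspaces of the fibers is closed under multiplication by the `x_j`:
this is the condition of being a T-invariant `ℂ[x₁,x₂,x₃]`-submodule of `M`. -/
def MultClosed (S : ∀ w : W3, Submodule ℂ (VF μ w)) : Prop :=
  ∀ (w : W3) (j : Fin 3), (S w).map (mapV μ j w) ≤ S (w + eW j)

/-- The family contains `O_C`. -/
def ContainsOC (S : ∀ w : W3, Submodule ℂ (VF μ w)) : Prop :=
  ∀ w : W3, ocSub μ w ≤ S w

/-- The family agrees with `O_C` away from finitely many weights (finitely generated
quotient). -/
def FiniteSupp (S : ∀ w : W3, Submodule ℂ (VF μ w)) : Prop :=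
  {w : W3 | S w ≠ ocSub μ w}.Finite

/-- weight types -/
def typeIminus (w : W3) : Prop := (∃ i, inCyl μ i w) ∧ ¬ nonnegW w

def typeII (w : W3) : Prop := nonnegW w ∧ numCyl μ w = 2

def typeIII (w : W3) : Prop := nonnegW w ∧ numCyl μ w = 3

/-- The configuration supports a box at `w` exactly when `S w` is strictly larger
than the fiber of `O_C`. -/
def SupportsBox (S : ∀ w : W3, Submodule ℂ (VF μ w)) (w : W3) : Prop :=
  S w ≠ ocSub μ w

/-- The line `ℂ · i_w` in the fiber. -/
def lineI (w : W3) (i : Fin 3) : Submodule ℂ (VF μ w) :=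
  Submodule.span ℂ {fun k => if k.1 = i then 1 else 0}

/-- A type III box at `w` labelled by the 1-dimensional subspace `ℂ · i_w`. -/
def labelledBy (S : ∀ w : W3, Submodule ℂ (VF μ w)) (w : W3) (i : Fin 3) : Prop :=
  typeIII μ w ∧ S w = ocSub μ w ⊔ lineI μ w i


/-!
STATEMENT 19: weighted box counting for the vertex with outgoing partitions
`μ¹ = (1), μ² = (2), μ³ = (1)`.  Components of the moduli of T-invariant submodules of
`M/O_C` are indexed by their (unlabelled) dimension data `D`; each component is a
product of ℙ¹'s, one per unrestricted path component of labelled type III boxes, so its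
topological Euler characteristic is `2 ^ (number of unrestricted components)`.  Summing
Euler characteristics of the components of box-length `ℓ = 0,1,2,3` yields `1, 2, 4, 7`:
`∑_{[Q]} χ_top(Q)(-q)^{ℓ(Q)} = 1 + 2(-q) + 4(-q)² + 7(-q)³ + O(q⁴)`.
-/

/-- A valid configuration: T-invariant finitely generated submodule of `M/O_C`. -/
def Valid (S : ∀ w : W3, Submodule ℂ (VF μ w)) : Prop :=
  MultClosed μ S ∧ ContainsOC μ S ∧ FiniteSupp μ S

variable (D : W3 → ℕ)

/-- The set of labelled type III boxes of the (unlabelled) configuration `D`. -/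
def LSet : Type := {w : W3 // typeIII μ w ∧ D w = 2}

/-- Adjacency of labelled type III boxes. -/
def adj (a b : LSet μ D) : Prop :=
  ∃ j : Fin 3, b.1 = a.1 + eW j ∨ a.1 = b.1 + eW j

/-- Path components of the set of labelled type III boxes. -/
def Comp : Type := Quot (adj μ D)

/-- A labelled box forcing the label of its component. -/
def restrictedAt (w : LSet μ D) : Prop :=
  (∃ j : Fin 3, typeII μ (w.1 + eW j) ∧ D (w.1 + eW j) = 1) ∨
  (∃ j : Fin 3, typeIminus μ (w.1 - eW j) ∧ D (w.1 - eW j) = 1)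

/-- A restricted path component. -/
def RestrictedC (c : Comp μ D) : Prop :=
  ∃ w : LSet μ D, Quot.mk (adj μ D) w = c ∧ restrictedAt μ D w

/-- The partition `(1)`. -/
def d1 : YoungDiagram :=
  ⟨{(0, 0)}, by
    intro a b hab hb
    simp only [Finset.coe_singleton, Set.mem_singleton_iff, Prod.ext_iff] at *
    obtain ⟨h1, h2⟩ := Prod.le_def.mp hab
    omega⟩

/-- The partition `(2)`. -/
def d2 : YoungDiagram :=
  ⟨{(0, 0), (0, 1)}, by
    intro a b hab hb
    simp only [Finset.coe_insert, Set.mem_insert_iff, Finset.coe_singleton,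
      Set.mem_singleton_iff, Prod.ext_iff] at *
    obtain ⟨h1, h2⟩ := Prod.le_def.mp hab
    omega⟩

/-- The outgoing partitions `((1), (2), (1))`. -/
def μex : Fin 3 → YoungDiagram := ![d1, d2, d1]

/-- `D` is the dimension data of an actual component of the moduli space. -/
def Realizable (D : W3 → ℕ) : Prop :=
  ∃ S : ∀ w : W3, Submodule ℂ (VF μex w),
    Valid μex S ∧ ∀ w, Module.finrank ℂ (S w) = D w

/-- The box-length of the configuration `D` (unlabelled type III boxes count twice). -/
def lenD (D : W3 → ℕ) : ℕ :=
  ∑ᶠ w : W3, (D w - Module.finrank ℂ (ocSub μex w))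

/-- The topological Euler characteristic of the component with data `D`:
a product of ℙ¹'s, one per unrestricted path component of labelled boxes. -/
def chi (D : W3 → ℕ) : ℕ :=
  2 ^ Nat.card {c : Comp μex D // ¬ RestrictedC μex D c}

/-- The set of components of box-length `l`. -/
def Cl (l : ℕ) : Set (W3 → ℕ) := {D | Realizable D ∧ lenD D = l}

theorem inCyl_zero_iff (w : W3) : inCyl μex 0 w ↔ w 1 = 0 ∧ w 2 = 0 := by
  simp only [inCyl, μex, d1, ← YoungDiagram.mem_cells, zero_add, Matrix.cons_val_zero,
    Finset.mem_singleton, Prod.mk.injEq]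
  omega

theorem inCyl_one_iff (w : W3) : inCyl μex 1 w ↔ w 2 = 0 ∧ (w 0 = 0 ∨ w 0 = 1) := by
  have h1 : (1 : Fin 3) + 1 = 2 := rfl
  have h2 : (1 : Fin 3) + 2 = 0 := rfl
  simp only [inCyl, μex, d2, ← YoungDiagram.mem_cells, h1, h2, Matrix.cons_val_one,
    Matrix.cons_val_zero, Finset.mem_insert, Finset.mem_singleton, Prod.mk.injEq]
  omega

theorem inCyl_two_iff (w : W3) : inCyl μex 2 w ↔ w 0 = 0 ∧ w 1 = 0 := by
  have h1 : (2 : Fin 3) + 1 = 0 := rfl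
  have h2 : (2 : Fin 3) + 2 = 1 := rfl
  simp only [inCyl, μex, d1, ← YoungDiagram.mem_cells, h1, h2, Matrix.cons_val,
    Finset.mem_singleton, Prod.mk.injEq]
  omega

/-- The vector `i_w` spanning `lineI μ w i`. -/
def basisV (w : W3) (i : Fin 3) : VF μ w := fun k => if k.1 = i then 1 else 0

section Fibers

variable {μ}

theorem mapV_basisV {w : W3} {i : Fin 3} (j : Fin 3) (hi : inCyl μ i w) :
    mapV μ j w (basisV μ w i) = basisV μ (w + eW j) i := by
  funext k
  by_cases hk : k.1 = i
  · simp [mapV, basisV, hk, hi]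
  · simp [mapV, basisV, hk]

theorem basisV_mem_of_eq_add {S : ∀ w : W3, Submodule ℂ (VF μ w)} (hS : MultClosed μ S)
    {w w' : W3} {i j : Fin 3} (hw : w' = w + eW j) (hi : inCyl μ i w)
    (h : basisV μ w i ∈ S w) : basisV μ w' i ∈ S w' := by
  subst hw
  rw [← mapV_basisV j hi]
  exact hS w j (Submodule.mem_map_of_mem h)

theorem ocSub_of_nonnegW {w : W3} (hw : nonnegW w) :
    ocSub μ w = Submodule.span ℂ {constV μ w} := if_pos hw

theorem ocSub_of_not_nonnegW {w : W3} (hw : ¬ nonnegW w) : ocSub μ w = ⊥ := if_neg hw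

theorem finrank_ocSub {w : W3} {i : Fin 3} (hw : nonnegW w) (hi : inCyl μ i w) :
    Module.finrank ℂ (ocSub μ w) = 1 := by
  rw [ocSub_of_nonnegW hw]
  exact finrank_span_singleton fun h => one_ne_zero (congrFun h ⟨i, hi⟩)

theorem ocSub_eq_top_of_nonnegW {w : W3} (hw : nonnegW w)
    (h : ∀ i j, inCyl μ i w → inCyl μ j w → i = j) : ocSub μ w = ⊤ := by
  rw [ocSub_of_nonnegW hw, eq_top_iff]
  intro f _
  rw [Submodule.mem_span_singleton]
  by_cases hc : ∃ i, inCyl μ i w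
  · obtain ⟨i, hi⟩ := hc
    refine ⟨f ⟨i, hi⟩, funext fun k => ?_⟩
    have : k = ⟨i, hi⟩ := Subtype.ext (h _ _ k.2 hi)
    simp [constV, this]
  · exact ⟨0, funext fun k => (hc ⟨k.1, k.2⟩).elim⟩

theorem eq_top_of_forall_not_inCyl {w : W3} (h : ∀ i, ¬ inCyl μ i w)
    (T : Submodule ℂ (VF μ w)) : T = ⊤ := by
  rw [eq_top_iff]
  intro f _
  have : f = 0 := funext fun k => (h _ k.2).elim
  exact this ▸ T.zero_mem

theorem finrank_eq_ite_of_unique {w : W3} {i : Fin 3} (hi : inCyl μ i w)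
    (h : ∀ j, inCyl μ j w → j = i) (T : Submodule ℂ (VF μ w)) :
    Module.finrank ℂ T = if basisV μ w i ∈ T then 1 else 0 := by
  have key (f : VF μ w) : f = f ⟨i, hi⟩ • basisV μ w i := by
    funext k
    have : k = ⟨i, hi⟩ := Subtype.ext (h _ k.2)
    simp [basisV, this]
  split_ifs with hT
  · have : T = Submodule.span ℂ {basisV μ w i} := by
      refine le_antisymm (fun f _ => ?_) (by simpa using hT)
      rw [key f]
      exact Submodule.smul_mem _ _ (Submodule.mem_span_singleton_self _)
    rw [this]
    refine finrank_span_singleton fun h0 => ?_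
    simpa [basisV] using congrFun h0 ⟨i, hi⟩
  · have : T = ⊥ := by
      rw [eq_bot_iff]
      intro f hf
      by_contra hne
      have hc : f ⟨i, hi⟩ ≠ 0 := fun h0 => hne (by rw [key f, h0, zero_smul]; simp)
      rw [key f] at hf
      exact hT ((T.smul_mem_iff hc).1 hf)
    rw [this, finrank_bot]

theorem finrank_span_constV_basisV {w : W3} {i j : Fin 3} (hi : inCyl μ i w)
    (hj : inCyl μ j w) (hij : j ≠ i) :
    Module.finrank ℂ (Submodule.span ℂ {constV μ w, basisV μ w i}) = 2 := by
  have hli : LinearIndependent ℂ ![constV μ w, basisV μ w i] := by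
    rw [LinearIndependent.pair_iff]
    intro s t h
    have h1 := congrFun h ⟨j, hj⟩
    have h2 := congrFun h ⟨i, hi⟩
    simp only [constV, basisV, Pi.add_apply, Pi.smul_apply, Pi.zero_apply, smul_eq_mul, hij,
      if_false, if_true] at h1 h2
    simp_all
  rw [← Matrix.range_cons_cons_empty _ _ ![], finrank_span_eq_card hli, Fintype.card_fin]

theorem ocSub_sup_lineI {w : W3} (hw : nonnegW w) (i : Fin 3) :
    ocSub μ w ⊔ lineI μ w i = Submodule.span ℂ {constV μ w, basisV μ w i} := by
  rw [ocSub_of_nonnegW hw, lineI, ← Submodule.span_union]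
  rfl

theorem two_le_finrank {w : W3} {i j : Fin 3} (hw : nonnegW w) (hi : inCyl μ i w)
    (hj : inCyl μ j w) (hij : j ≠ i) {T : Submodule ℂ (VF μ w)} (hT : ocSub μ w ≤ T)
    (h : basisV μ w i ∈ T) : 2 ≤ Module.finrank ℂ T := by
  rw [← finrank_span_constV_basisV hi hj hij]
  refine Submodule.finrank_mono (Submodule.span_le.2 ?_)
  rw [ocSub_of_nonnegW hw] at hT
  rintro x (rfl | rfl)
  exacts [hT (Submodule.mem_span_singleton_self _), h]

theorem eq_top_of_forall_basisV_mem {w : W3} {T : Submodule ℂ (VF μ w)}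
    (h : ∀ i, inCyl μ i w → basisV μ w i ∈ T) : T = ⊤ := by
  rw [eq_top_iff]
  intro f _
  have : f = ∑ k, f k • basisV μ w k.1 := by
    funext l
    simp [basisV, Finset.sum_apply, ← Subtype.ext_iff]
  rw [this]
  exact T.sum_mem fun k _ => T.smul_mem _ (h _ k.2)

theorem constV_mem {w : W3} (hw : nonnegW w) {T : Submodule ℂ (VF μ w)}
    (hT : ocSub μ w ≤ T) : constV μ w ∈ T :=
  hT (ocSub_of_nonnegW (μ := μ) hw ▸ Submodule.mem_span_singleton_self _)

theorem basisV_eq_zero {w : W3} {i : Fin 3} (hi : ¬ inCyl μ i w) : basisV μ w i = 0 :=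
  funext fun k => if_neg fun h : k.1 = i => hi (h ▸ k.2)

theorem inCyl_of_inCyl_add {w : W3} {i j : Fin 3} (hw : nonnegW w)
    (h : inCyl μ i (w + eW j)) : inCyl μ i w := by
  have hle (k : Fin 3) : w k ≤ (w + eW j) k := by
    simp only [Pi.add_apply, eW]
    split_ifs <;> omega
  exact ⟨hw _, hw _, (μ i).up_left_mem (Int.toNat_le_toNat (hle _))
    (Int.toNat_le_toNat (hle _)) h.2.2⟩

theorem map_mapV_ocSub_le (w : W3) (j : Fin 3) :
    (ocSub μ w).map (mapV μ j w) ≤ ocSub μ (w + eW j) := by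
  by_cases hw : nonnegW w
  · have hw' : nonnegW (w + eW j) := fun i => by
      have := hw i
      simp only [Pi.add_apply, eW]
      split_ifs <;> omega
    rw [ocSub_of_nonnegW hw, ocSub_of_nonnegW hw', Submodule.map_span, Set.image_singleton]
    have : mapV μ j w (constV μ w) = constV μ (w + eW j) :=
      funext fun k => dif_pos (inCyl_of_inCyl_add hw k.2)
    rw [this]
  · rw [ocSub_of_not_nonnegW hw, Submodule.map_bot]
    exact bot_le

end Fibers

/-- The weights with a negative coordinate in the cylinder along the `x₁`-axis. -/
def legX (k : ℕ) : W3 := ![-(k : ℤ) - 1, 0, 0]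

/-- The weights with a negative coordinate in the cylinder along the `x₂`-axis, over the
first box of its cross-section. -/
def legY (k : ℕ) : W3 := ![0, -(k : ℤ) - 1, 0]

/-- The weights with a negative coordinate in the cylinder along the `x₂`-axis, over the
second box of its cross-section. -/
def legV (k : ℕ) : W3 := ![1, -(k : ℤ) - 1, 0]

/-- The weights with a negative coordinate in the cylinder along the `x₃`-axis. -/
def legZ (k : ℕ) : W3 := ![0, 0, -(k : ℤ) - 1]

theorem W3.ext_iff (v w : W3) : v = w ↔ v 0 = w 0 ∧ v 1 = w 1 ∧ v 2 = w 2 := by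
  simp [funext_iff, Fin.forall_fin_succ]

theorem nonnegW_iff (w : W3) : nonnegW w ↔ 0 ≤ w 0 ∧ 0 ≤ w 1 ∧ 0 ≤ w 2 := by
  simp [nonnegW, Fin.forall_fin_succ]

theorem exists_eq_legX_iff (w : W3) : (∃ k, w = legX k) ↔ w 0 < 0 ∧ w 1 = 0 ∧ w 2 = 0 := by
  simp only [W3.ext_iff, legX, Matrix.cons_val]
  exact ⟨by rintro ⟨k, h⟩; omega, fun h => ⟨(-w 0 - 1).toNat, by omega⟩⟩

theorem exists_eq_legY_iff (w : W3) : (∃ k, w = legY k) ↔ w 0 = 0 ∧ w 1 < 0 ∧ w 2 = 0 := by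
  simp only [W3.ext_iff, legY, Matrix.cons_val]
  exact ⟨by rintro ⟨k, h⟩; omega, fun h => ⟨(-w 1 - 1).toNat, by omega⟩⟩

theorem exists_eq_legV_iff (w : W3) : (∃ k, w = legV k) ↔ w 0 = 1 ∧ w 1 < 0 ∧ w 2 = 0 := by
  simp only [W3.ext_iff, legV, Matrix.cons_val]
  exact ⟨by rintro ⟨k, h⟩; omega, fun h => ⟨(-w 1 - 1).toNat, by omega⟩⟩

theorem exists_eq_legZ_iff (w : W3) : (∃ k, w = legZ k) ↔ w 0 = 0 ∧ w 1 = 0 ∧ w 2 < 0 := by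
  simp only [W3.ext_iff, legZ, Matrix.cons_val]
  exact ⟨by rintro ⟨k, h⟩; omega, fun h => ⟨(-w 2 - 1).toNat, by omega⟩⟩

/-- `w` is one of the weights at which the fiber of `M/O_C` vanishes. -/
def IsPlain (w : W3) : Prop :=
  w ≠ 0 ∧ w ≠ eW 0 ∧ (∀ k, w ≠ legX k) ∧ (∀ k, w ≠ legY k) ∧ (∀ k, w ≠ legV k) ∧
    ∀ k, w ≠ legZ k

theorem eW_zero_apply : eW 0 0 = 1 ∧ eW 0 1 = 0 ∧ eW 0 2 = 0 := by simp [eW]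

theorem IsPlain.ocSub_eq_top {w : W3} (hw : IsPlain w) : ocSub μex w = ⊤ := by
  obtain ⟨h0, h1, hX, hY, hV, hZ⟩ := hw
  have hX := mt (exists_eq_legX_iff w).2 (by simpa using hX)
  have hY := mt (exists_eq_legY_iff w).2 (by simpa using hY)
  have hV := mt (exists_eq_legV_iff w).2 (by simpa using hV)
  have hZ := mt (exists_eq_legZ_iff w).2 (by simpa using hZ)
  obtain ⟨e0, e1, e2⟩ := eW_zero_apply
  simp only [ne_eq, W3.ext_iff, e0, e1, e2, Pi.zero_apply] at h0 h1
  have c0 := inCyl_zero_iff w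
  have c1 := inCyl_one_iff w
  have c2 := inCyl_two_iff w
  by_cases hn : nonnegW w
  · refine ocSub_eq_top_of_nonnegW hn ?_
    rw [nonnegW_iff] at hn
    intro i j hi hj
    fin_cases i <;> fin_cases j <;> first | rfl | (exfalso; simp [c0, c1, c2] at hi hj; omega)
  · refine eq_top_of_forall_not_inCyl ?_ _
    rw [nonnegW_iff] at hn
    intro i hi
    fin_cases i <;> simp [c0, c1, c2] at hi <;> omega

theorem IsPlain.eq_ocSub {w : W3} (hw : IsPlain w) {T : Submodule ℂ (VF μex w)}
    (hT : ocSub μex w ≤ T) : T = ocSub μex w := by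
  rw [hw.ocSub_eq_top] at hT ⊢
  exact top_le_iff.1 hT

theorem weight_cases (w : W3) : w = 0 ∨ w = eW 0 ∨ (∃ k, w = legX k) ∨ (∃ k, w = legY k) ∨
    (∃ k, w = legV k) ∨ (∃ k, w = legZ k) ∨ IsPlain w := by
  simp only [IsPlain, ← not_exists, ne_eq]
  tauto

theorem inCyl_origin (i : Fin 3) : inCyl μex i 0 := by
  fin_cases i
  exacts [(inCyl_zero_iff 0).2 (by simp), (inCyl_one_iff 0).2 (by simp),
    (inCyl_two_iff 0).2 (by simp)]

theorem nonnegW_zero : nonnegW 0 := fun _ => le_rfl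

theorem nonnegW_eW (j : Fin 3) : nonnegW (eW j) := fun i => by
  simp only [eW]; split_ifs <;> simp

theorem inCyl_zero_side : inCyl μex 0 (eW 0) := (inCyl_zero_iff _).2 (by simp [eW])

theorem inCyl_one_side : inCyl μex 1 (eW 0) := (inCyl_one_iff _).2 (by simp [eW])

theorem not_inCyl_two_side : ¬ inCyl μex 2 (eW 0) := by simp [inCyl_two_iff, eW]

theorem inCyl_legX (k : ℕ) : inCyl μex 0 (legX k) := (inCyl_zero_iff _).2 (by simp [legX])

theorem inCyl_legY (k : ℕ) : inCyl μex 1 (legY k) := (inCyl_one_iff _).2 (by simp [legY])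

theorem inCyl_legV (k : ℕ) : inCyl μex 1 (legV k) := (inCyl_one_iff _).2 (by simp [legV])

theorem inCyl_legZ (k : ℕ) : inCyl μex 2 (legZ k) := (inCyl_two_iff _).2 (by simp [legZ])

theorem eq_of_inCyl_of_neg {w : W3} {i : Fin 3} (hw : w i < 0) :
    ∀ j, inCyl μex j w → j = i := by
  intro j hj
  have c0 := inCyl_zero_iff w
  have c1 := inCyl_one_iff w
  have c2 := inCyl_two_iff w
  fin_cases i <;> fin_cases j <;>
    first | rfl | (exfalso; simp [c0, c1, c2] at hj hw; omega)

theorem not_nonnegW_of_neg {w : W3} {i : Fin 3} (hw : w i < 0) : ¬ nonnegW w :=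
  fun h => (h i).not_gt hw

theorem legX_neg (k : ℕ) : legX k 0 < 0 := by simp [legX]; omega

theorem legY_neg (k : ℕ) : legY k 1 < 0 := by simp [legY]; omega

theorem legV_neg (k : ℕ) : legV k 1 < 0 := by simp [legV]; omega

theorem legZ_neg (k : ℕ) : legZ k 2 < 0 := by simp [legZ]; omega

theorem legX_injective : Function.Injective legX := fun a b h => by
  have := congrFun h 0
  simpa [legX] using this

theorem legY_injective : Function.Injective legY := fun a b h => by
  have := congrFun h 1
  simpa [legY] using this

theorem legV_injective : Function.Injective legV := fun a b h => by
  have := congrFun h 1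
  simpa [legV] using this

theorem legZ_injective : Function.Injective legZ := fun a b h => by
  have := congrFun h 2
  simpa [legZ] using this

/-- Numerical data of a box configuration: the excess dimensions at the origin and at the
type II weight `eW 0`, and the number of boxes in each column of negative weights. -/
@[ext]
structure Config where
  /-- excess dimension at the origin -/
  orig : ℕ
  /-- excess dimension at `eW 0` -/
  side : ℕ
  /-- number of boxes in the column `legX` -/
  nX : ℕ
  /-- number of boxes in the column `legY` -/
  nY : ℕ
  /-- number of boxes in the column `legV` -/
  nV : ℕ
  /-- number of boxes in the column `legZ` -/
  nZ : ℕ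

namespace Config

/-- The closure rules for box configurations. -/
def Good (t : Config) : Prop :=
  t.orig ≤ 2 ∧ t.side ≤ 1 ∧ t.nY ≤ t.nV ∧ (0 < t.nV ∨ 0 < t.nX ∨ t.orig = 2 → t.side = 1) ∧
    (0 < t.nX ∨ 0 < t.nY ∨ 0 < t.nZ → 1 ≤ t.orig) ∧
    ((0 < t.nX ∧ 0 < t.nY) ∨ (0 < t.nX ∧ 0 < t.nZ) ∨ (0 < t.nY ∧ 0 < t.nZ) → t.orig = 2)

/-- The total number of boxes. -/
def len (t : Config) : ℕ := t.orig + t.side + t.nX + t.nY + t.nV + t.nZ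

/-- The Euler characteristic of the component of `t`. -/
def euler (t : Config) : ℕ :=
  if t.orig = 1 ∧ t.side ≠ 0 ∧ t.nX = 0 ∧ t.nY = 0 ∧ t.nZ = 0 then 2 else 1

/-- The excess dimension over `O_C` at each weight. -/
def excess (t : Config) (w : W3) : ℕ :=
  (if w ∈ ({0} : Finset W3) then t.orig else 0) +
  (if w ∈ ({eW 0} : Finset W3) then t.side else 0) +
  (if w ∈ (Finset.range t.nX).image legX then 1 else 0) +
  (if w ∈ (Finset.range t.nY).image legY then 1 else 0) +
  (if w ∈ (Finset.range t.nV).image legV then 1 else 0) +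
  (if w ∈ (Finset.range t.nZ).image legZ then 1 else 0)

/-- The dimension data of the configuration `t`. -/
def dims (t : Config) (w : W3) : ℕ := Module.finrank ℂ (ocSub μex w) + t.excess w

variable (t : Config)

theorem neg_sub_one_ne (n : ℕ) {z : ℤ} (hz : 0 ≤ z) : -(n : ℤ) - 1 ≠ z := by omega

theorem excess_zero : t.excess 0 = t.orig := by
  simp [excess, W3.ext_iff, eW, legX, legY, legV, legZ, neg_sub_one_ne]

theorem excess_side : t.excess (eW 0) = t.side := by
  simp [excess, W3.ext_iff, eW, legX, legY, legV, legZ, neg_sub_one_ne]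

theorem excess_legX (k : ℕ) : t.excess (legX k) = if k < t.nX then 1 else 0 := by
  simp [excess, W3.ext_iff, eW, legX, legY, legV, legZ, neg_sub_one_ne,
    (neg_sub_one_ne _ _).symm]

theorem excess_legY (k : ℕ) : t.excess (legY k) = if k < t.nY then 1 else 0 := by
  simp [excess, W3.ext_iff, eW, legX, legY, legV, legZ, neg_sub_one_ne,
    (neg_sub_one_ne _ _).symm]

theorem excess_legV (k : ℕ) : t.excess (legV k) = if k < t.nV then 1 else 0 := by
  simp [excess, W3.ext_iff, eW, legX, legY, legV, legZ, neg_sub_one_ne,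
    (neg_sub_one_ne _ _).symm]

theorem excess_legZ (k : ℕ) : t.excess (legZ k) = if k < t.nZ then 1 else 0 := by
  simp [excess, W3.ext_iff, eW, legX, legY, legV, legZ, neg_sub_one_ne,
    (neg_sub_one_ne _ _).symm]

theorem excess_of_isPlain {w : W3} (hw : IsPlain w) : t.excess w = 0 := by
  obtain ⟨h0, h1, hX, hY, hV, hZ⟩ := hw
  simp [excess, h0, h1, fun k => (hX k).symm, fun k => (hY k).symm, fun k => (hV k).symm,
    fun k => (hZ k).symm]

theorem dims_injective : Function.Injective dims := by
  intro s t h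
  have hE (w : W3) : s.excess w = t.excess w := by
    have := congrFun h w
    simpa [dims] using this
  have aux {a b : ℕ} (hab : ∀ k, (if k < a then 1 else 0) = if k < b then 1 else 0) : a = b := by
    have h1 := hab a
    have h2 := hab b
    split_ifs at h1 h2 <;> omega
  have hX := aux fun k => by simpa [excess_legX] using hE (legX k)
  have hY := aux fun k => by simpa [excess_legY] using hE (legY k)
  have hV := aux fun k => by simpa [excess_legV] using hE (legV k)
  have hZ := aux fun k => by simpa [excess_legZ] using hE (legZ k)
  have h0 := hE 0
  have h1 := hE (eW 0)
  rw [excess_zero, excess_zero] at h0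
  rw [excess_side, excess_side] at h1
  exact Config.ext h0 h1 hX hY hV hZ

theorem finite_support_add {f g : W3 → ℕ} (hf : (Function.support f).Finite)
    (hg : (Function.support g).Finite) : (Function.support fun w => f w + g w).Finite :=
  (hf.union hg).subset (Function.support_add f g)

theorem finite_support_ite (s : Finset W3) (c : ℕ) :
    (Function.support fun w => if w ∈ s then c else 0).Finite :=
  s.finite_toSet.subset fun w hw => by
    by_contra h
    simp_all

theorem finsum_ite_mem (s : Finset W3) (c : ℕ) :
    ∑ᶠ w, (if w ∈ s then c else 0) = s.card * c := by
  rw [finsum_eq_sum_of_support_subset (s := s) _ fun w hw => by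
    by_contra h
    simp_all]
  simp

theorem finite_support_excess : (Function.support t.excess).Finite := by
  iterate 5 refine finite_support_add ?_ (finite_support_ite _ _)
  exact finite_support_ite _ _

theorem lenD_dims : lenD t.dims = t.len := by
  have h1 := finite_support_ite {0} t.orig
  have h2 := finite_support_add h1 (finite_support_ite {eW 0} t.side)
  have h3 := finite_support_add h2 (finite_support_ite ((Finset.range t.nX).image legX) 1)
  have h4 := finite_support_add h3 (finite_support_ite ((Finset.range t.nY).image legY) 1)
  have h5 := finite_support_add h4 (finite_support_ite ((Finset.range t.nV).image legV) 1)
  simp only [lenD, dims, Nat.add_sub_cancel_left, excess]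
  rw [finsum_add_distrib h5 (finite_support_ite _ _),
    finsum_add_distrib h4 (finite_support_ite _ _),
    finsum_add_distrib h3 (finite_support_ite _ _),
    finsum_add_distrib h2 (finite_support_ite _ _),
    finsum_add_distrib h1 (finite_support_ite _ _)]
  simp only [finsum_ite_mem, Finset.card_image_of_injective _ legX_injective,
    Finset.card_image_of_injective _ legY_injective,
    Finset.card_image_of_injective _ legV_injective,
    Finset.card_image_of_injective _ legZ_injective]
  simp [len]

theorem dims_zero : t.dims 0 = 1 + t.orig := by
  rw [dims, finrank_ocSub nonnegW_zero (inCyl_origin 0), excess_zero]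

theorem dims_side : t.dims (eW 0) = 1 + t.side := by
  rw [dims, finrank_ocSub (nonnegW_eW 0) inCyl_zero_side, excess_side]

theorem dims_of_neg {w : W3} {i : Fin 3} (hw : w i < 0) : t.dims w = t.excess w := by
  rw [dims, ocSub_of_not_nonnegW (not_nonnegW_of_neg hw), finrank_bot, zero_add]

end Config

theorem numCyl_eq (w : W3) : numCyl μex w =
    (if w 1 = 0 ∧ w 2 = 0 then 1 else 0) + (if w 2 = 0 ∧ (w 0 = 0 ∨ w 0 = 1) then 1 else 0) +
      (if w 0 = 0 ∧ w 1 = 0 then 1 else 0) := by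
  rw [numCyl, Nat.card_eq_fintype_card, Fintype.card_subtype, Finset.card_filter,
    Fin.sum_univ_three]
  simp only [inCyl_zero_iff, inCyl_one_iff, inCyl_two_iff]

theorem finrank_VF (w : W3) : Module.finrank ℂ (VF μex w) = numCyl μex w := by
  rw [Module.finrank_fintype_fun_eq_card, numCyl, Nat.card_eq_fintype_card]

theorem numCyl_zero : numCyl μex 0 = 3 := by simp [numCyl_eq]

theorem numCyl_side : numCyl μex (eW 0) = 2 := by simp [numCyl_eq, eW]

theorem typeIII_iff (w : W3) : typeIII μex w ↔ w = 0 := by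
  constructor
  · rintro ⟨-, h⟩
    rw [numCyl_eq] at h
    rw [W3.ext_iff]
    split_ifs at h <;> simp_all
  · rintro rfl
    exact ⟨nonnegW_zero, numCyl_zero⟩

theorem typeII_eW_iff (j : Fin 3) : typeII μex (eW j) ↔ j = 0 := by
  rw [typeII, numCyl_eq]
  have := nonnegW_eW j
  fin_cases j <;> simp_all [eW]

theorem zero_sub_eW_zero : 0 - eW 0 = legX 0 := by simp [W3.ext_iff, eW, legX]

theorem zero_sub_eW_one : 0 - eW 1 = legY 0 := by simp [W3.ext_iff, eW, legY]

theorem zero_sub_eW_two : 0 - eW 2 = legZ 0 := by simp [W3.ext_iff, eW, legZ]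

theorem typeIminus_of_neg {w : W3} {i : Fin 3} (hi : inCyl μex i w) (hw : w i < 0) :
    typeIminus μex w := ⟨⟨i, hi⟩, not_nonnegW_of_neg hw⟩

namespace Config

variable (t : Config)

theorem restrictedAt_iff (w : LSet μex t.dims) : restrictedAt μex t.dims w ↔
    t.side = 0 ∨ 0 < t.nX ∨ 0 < t.nY ∨ 0 < t.nZ := by
  have hw : w.1 = 0 := (typeIII_iff _).1 w.2.1
  rw [restrictedAt, hw]
  refine or_congr ?_ ?_
  · simp [typeII_eW_iff, dims_side]
  · rw [Fin.exists_fin_succ, Fin.exists_fin_succ, Fin.exists_fin_one]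
    have hX := typeIminus_of_neg (inCyl_legX 0) (legX_neg 0)
    have hY := typeIminus_of_neg (inCyl_legY 0) (legY_neg 0)
    have hZ := typeIminus_of_neg (inCyl_legZ 0) (legZ_neg 0)
    simp only [Fin.succ_zero_eq_one, Fin.succ_one_eq_two, zero_sub_eW_zero, zero_sub_eW_one,
      zero_sub_eW_two, hX, hY, hZ, true_and, t.dims_of_neg (legX_neg 0), excess_legX,
      t.dims_of_neg (legY_neg 0), excess_legY, t.dims_of_neg (legZ_neg 0), excess_legZ]
    simp [Nat.pos_iff_ne_zero]

theorem chi_dims : chi t.dims = t.euler := by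
  rw [chi, euler]
  split_ifs with h
  · have w : LSet μex t.dims := ⟨0, (typeIII_iff 0).2 rfl, by rw [dims_zero, h.1]⟩
    have hL : Subsingleton (LSet μex t.dims) := ⟨fun a b => Subtype.ext
      (((typeIII_iff _).1 a.2.1).trans ((typeIII_iff _).1 b.2.1).symm)⟩
    have : Nat.card {c : Comp μex t.dims // ¬ RestrictedC μex t.dims c} = 1 := by
      rw [Nat.card_eq_one_iff_unique]
      refine ⟨⟨?_⟩, ⟨⟨Quot.mk _ w, ?_⟩⟩⟩
      · rintro ⟨⟨a⟩, _⟩ ⟨⟨b⟩, _⟩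
        exact Subtype.ext (congrArg (Quot.mk _) (hL.elim a b))
      · rintro ⟨v, -, hv⟩
        rw [restrictedAt_iff] at hv
        omega
    rw [this, pow_one]
  · have : IsEmpty {c : Comp μex t.dims // ¬ RestrictedC μex t.dims c} := by
      refine ⟨?_⟩
      rintro ⟨⟨w⟩, hc⟩
      refine hc ⟨w, rfl, ?_⟩
      have hw : w.1 = 0 := (typeIII_iff _).1 w.2.1
      have h2 := w.2.2
      rw [hw, dims_zero] at h2
      rw [restrictedAt_iff]
      omega
    rw [Nat.card_of_isEmpty, pow_zero]

end Config

section Necessity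

theorem exists_forall_iff_lt {P : ℕ → Prop} (hP : ∀ k, P (k + 1) → P k)
    (hfin : {k | P k}.Finite) : ∃ a, ∀ k, P k ↔ k < a := by
  have hex : ∃ k, ¬ P k := by
    by_contra! h
    exact Set.infinite_univ (hfin.subset fun k _ => h k)
  have hanti {m n : ℕ} (hmn : m ≤ n) : P n → P m := by
    induction hmn with
    | refl => exact id
    | step _ ih => exact fun h => ih (hP _ h)
  refine ⟨Nat.find hex, fun k => ⟨fun hk => ?_, fun hk => not_not.1 (Nat.find_min hex hk)⟩⟩
  by_contra! h
  exact Nat.find_spec hex (hanti h hk)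

variable {S : ∀ w : W3, Submodule ℂ (VF μex w)}

/-- Along a column of negative weights the boxes form an initial segment. -/
theorem exists_column_length (hS : Valid μex S) {leg : ℕ → W3} {i : Fin 3}
    (hinj : Function.Injective leg) (hneg : ∀ k, leg k i < 0) (hcyl : ∀ k, inCyl μex i (leg k))
    (hstep : ∀ k, leg k = leg (k + 1) + eW i) :
    ∃ a, ∀ k, basisV μex (leg k) i ∈ S (leg k) ↔ k < a := by
  refine exists_forall_iff_lt
    (fun k => basisV_mem_of_eq_add hS.1 (hstep k) (hcyl _)) ?_
  refine (hS.2.2.preimage hinj.injOn).subset fun k hk h => ?_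
  rw [Set.mem_ofPred_eq, h, ocSub_of_not_nonnegW (not_nonnegW_of_neg (hneg k)),
    Submodule.mem_bot] at hk
  simpa [basisV] using congrFun hk ⟨i, hcyl k⟩

theorem forall_basisV_mem_origin {T : Submodule ℂ (VF μex 0)} (hT : ocSub μex 0 ≤ T)
    {i j : Fin 3} (hij : i ≠ j) (hi : basisV μex 0 i ∈ T) (hj : basisV μex 0 j ∈ T) : T = ⊤ := by
  refine eq_top_of_forall_basisV_mem fun k _ => ?_
  by_cases hki : k = i
  · exact hki ▸ hi
  by_cases hkj : k = j
  · exact hkj ▸ hj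
  have : basisV μex 0 k = constV μex 0 - basisV μex 0 i - basisV μex 0 j := by
    funext ⟨l, _⟩
    simp only [basisV, constV, Pi.sub_apply]
    have : l = i ∨ l = j ∨ l = k := by omega
    rcases this with rfl | rfl | rfl <;> simp_all [eq_comm]
  rw [this]
  exact T.sub_mem (T.sub_mem (constV_mem nonnegW_zero hT) hi) hj

theorem exists_good_config (hS : Valid μex S) :
    ∃ t : Config, t.Good ∧ ∀ w, Module.finrank ℂ (S w) = t.dims w := by
  obtain ⟨a, ha⟩ := exists_column_length hS legX_injective legX_neg inCyl_legX
    fun k => by rw [W3.ext_iff]; simp [legX, eW]; omega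
  obtain ⟨b, hb⟩ := exists_column_length hS legY_injective legY_neg inCyl_legY
    fun k => by rw [W3.ext_iff]; simp [legY, eW]; omega
  obtain ⟨d, hd⟩ := exists_column_length hS legV_injective legV_neg inCyl_legV
    fun k => by rw [W3.ext_iff]; simp [legV, eW]; omega
  obtain ⟨c, hc⟩ := exists_column_length hS legZ_injective legZ_neg inCyl_legZ
    fun k => by rw [W3.ext_iff]; simp [legZ, eW]; omega
  have push {w w' : W3} {i : Fin 3} (j : Fin 3) (hw : w' = w + eW j) (hi : inCyl μex i w)
      (h : basisV μex w i ∈ S w) : basisV μex w' i ∈ S w' := basisV_mem_of_eq_add hS.1 hw hi h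
  have hO := hS.2.1 0
  have hP := hS.2.1 (eW 0)
  have hO1 := Submodule.finrank_mono hO
  have hP1 := Submodule.finrank_mono hP
  rw [finrank_ocSub nonnegW_zero (inCyl_origin 0)] at hO1
  rw [finrank_ocSub (nonnegW_eW 0) inCyl_zero_side] at hP1
  have hO3 := (S 0).finrank_le
  have hP2 := (S (eW 0)).finrank_le
  rw [finrank_VF, numCyl_zero] at hO3
  rw [finrank_VF, numCyl_side] at hP2
  have aO (h : 0 < a) : basisV μex 0 0 ∈ S 0 :=
    push 0 (by rw [W3.ext_iff]; simp [legX, eW]) (inCyl_legX 0) ((ha 0).2 h)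
  have bO (h : 0 < b) : basisV μex 0 1 ∈ S 0 :=
    push 1 (by rw [W3.ext_iff]; simp [legY, eW]) (inCyl_legY 0) ((hb 0).2 h)
  have cO (h : 0 < c) : basisV μex 0 2 ∈ S 0 :=
    push 2 (by rw [W3.ext_iff]; simp [legZ, eW]) (inCyl_legZ 0) ((hc 0).2 h)
  have OP (h : basisV μex 0 0 ∈ S 0) : 2 ≤ Module.finrank ℂ (S (eW 0)) :=
    two_le_finrank (nonnegW_eW 0) inCyl_zero_side inCyl_one_side (by decide) hP
      (push 0 (by simp) (inCyl_origin 0) h)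
  have dP (h : 0 < d) : 2 ≤ Module.finrank ℂ (S (eW 0)) :=
    two_le_finrank (nonnegW_eW 0) inCyl_one_side inCyl_zero_side (by decide) hP
      (push 1 (by rw [W3.ext_iff]; simp [legV, eW]) (inCyl_legV 0) ((hd 0).2 h))
  have hbd : b ≤ d := by
    by_contra! h
    exact lt_irrefl d ((hd d).1
      (push 0 (by rw [W3.ext_iff]; simp [legY, legV, eW]) (inCyl_legY d) ((hb d).2 h)))
  have top (h : Module.finrank ℂ (S 0) = 3) : 2 ≤ Module.finrank ℂ (S (eW 0)) := by
    refine OP ?_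
    rw [Submodule.eq_top_of_finrank_eq (h.trans (numCyl_zero.symm.trans (finrank_VF 0).symm))]
    trivial
  have one {i : Fin 3} (h : basisV μex 0 i ∈ S 0) : 2 ≤ Module.finrank ℂ (S 0) :=
    two_le_finrank nonnegW_zero (inCyl_origin i) (inCyl_origin (i + 1)) (by simp) hO h
  have two {i j : Fin 3} (hij : i ≠ j) (hi : basisV μex 0 i ∈ S 0)
      (hj : basisV μex 0 j ∈ S 0) : Module.finrank ℂ (S 0) = 3 := by
    rw [forall_basisV_mem_origin hO hij hi hj, finrank_top, finrank_VF, numCyl_zero]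
  refine ⟨⟨Module.finrank ℂ (S 0) - 1, Module.finrank ℂ (S (eW 0)) - 1, a, b, d, c⟩,
    ⟨by grind, by grind, hbd, ?_, ?_, ?_⟩, fun w => ?_⟩
  · rintro (h | h | h)
    · have := dP h
      grind
    · have := OP (aO h)
      grind
    · have := top (by grind)
      grind
  · rintro (h | h | h)
    · have := one (aO h)
      grind
    · have := one (bO h)
      grind
    · have := one (cO h)
      grind
  · rintro (⟨h, h'⟩ | ⟨h, h'⟩ | ⟨h, h'⟩)
    · have := two (by decide) (aO h) (bO h')
      grind
    · have := two (by decide) (aO h) (cO h')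
      grind
    · have := two (by decide) (bO h) (cO h')
      grind
  · rcases weight_cases w with rfl | rfl | ⟨k, rfl⟩ | ⟨k, rfl⟩ | ⟨k, rfl⟩ | ⟨k, rfl⟩ | hw
    · rw [Config.dims_zero]
      exact (Nat.add_sub_cancel' hO1).symm
    · rw [Config.dims_side]
      exact (Nat.add_sub_cancel' hP1).symm
    · rw [Config.dims_of_neg _ (legX_neg k), Config.excess_legX,
        finrank_eq_ite_of_unique (inCyl_legX k) (eq_of_inCyl_of_neg (legX_neg k))]
      simp only [ha]
    · rw [Config.dims_of_neg _ (legY_neg k), Config.excess_legY,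
        finrank_eq_ite_of_unique (inCyl_legY k) (eq_of_inCyl_of_neg (legY_neg k))]
      simp only [hb]
    · rw [Config.dims_of_neg _ (legV_neg k), Config.excess_legV,
        finrank_eq_ite_of_unique (inCyl_legV k) (eq_of_inCyl_of_neg (legV_neg k))]
      simp only [hd]
    · rw [Config.dims_of_neg _ (legZ_neg k), Config.excess_legZ,
        finrank_eq_ite_of_unique (inCyl_legZ k) (eq_of_inCyl_of_neg (legZ_neg k))]
      simp only [hc]
    · rw [Config.dims, Config.excess_of_isPlain _ hw, hw.eq_ocSub (hS.2.1 w), add_zero]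

end Necessity

namespace Config

variable (t : Config)

/-- The weights at which the submodule built from `t` contains the basis vector of each
cylinder. -/
def HasBasis (i : Fin 3) (w : W3) : Prop :=
  ![(w 0 < 0 → -w 0 ≤ t.nX) ∧ (w 0 = 0 → t.orig = 2 ∨ t.orig = 1 ∧ 0 < t.nX) ∧
      (w 0 = 1 → t.side = 1),
    (w 0 = 0 → (w 1 < 0 → -w 1 ≤ t.nY) ∧ (w 1 = 0 → t.orig = 2 ∨ t.orig = 1 ∧ 0 < t.nY)) ∧
      (w 0 = 1 → (w 1 < 0 → -w 1 ≤ t.nV) ∧ (w 1 = 0 → t.side = 1)),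
    (w 2 < 0 → -w 2 ≤ t.nZ) ∧ (w 2 = 0 → t.orig = 2 ∨ t.orig = 1 ∧ t.nX = 0 ∧ t.nY = 0)] i

/-- The submodule of `M` realizing `t`. -/
def toSub (w : W3) : Submodule ℂ (VF μex w) :=
  ocSub μex w ⊔ Submodule.span ℂ {v | ∃ i, t.HasBasis i w ∧ v = basisV μex w i}

theorem basisV_mem_toSub {i : Fin 3} {w : W3} (h : t.HasBasis i w) :
    basisV μex w i ∈ t.toSub w :=
  Submodule.mem_sup_right (Submodule.subset_span ⟨i, h, rfl⟩)

theorem ocSub_le_toSub (w : W3) : ocSub μex w ≤ t.toSub w := le_sup_left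

theorem toSub_le {w : W3} {T : Submodule ℂ (VF μex w)} (hT : ocSub μex w ≤ T)
    (h : ∀ i, inCyl μex i w → t.HasBasis i w → basisV μex w i ∈ T) : t.toSub w ≤ T := by
  refine sup_le hT (Submodule.span_le.2 ?_)
  rintro v ⟨i, hi, rfl⟩
  by_cases hc : inCyl μex i w
  · exact h i hc hi
  · rw [basisV_eq_zero hc]
    exact T.zero_mem

theorem toSub_eq_ocSub {w : W3} (h : ∀ i, inCyl μex i w → ¬ t.HasBasis i w) :
    t.toSub w = ocSub μex w :=
  le_antisymm (t.toSub_le le_rfl fun i hc hi => (h i hc hi).elim) (t.ocSub_le_toSub w)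

theorem finrank_toSub_of_neg {w : W3} {i : Fin 3} (hw : w i < 0) (hi : inCyl μex i w) :
    Module.finrank ℂ (t.toSub w) = if t.HasBasis i w then 1 else 0 := by
  split_ifs with h
  · rw [finrank_eq_ite_of_unique hi (eq_of_inCyl_of_neg hw), if_pos (t.basisV_mem_toSub h)]
  · rw [t.toSub_eq_ocSub fun j hj => eq_of_inCyl_of_neg hw j hj ▸ h,
      ocSub_of_not_nonnegW (not_nonnegW_of_neg hw), finrank_bot]

theorem finrank_toSub_of_forall {w : W3} (h : ∀ i, inCyl μex i w → t.HasBasis i w) :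
    Module.finrank ℂ (t.toSub w) = numCyl μex w := by
  rw [eq_top_of_forall_basisV_mem fun i hi => t.basisV_mem_toSub (h i hi), finrank_top,
    finrank_VF]

theorem finrank_toSub_origin_of_unique {i : Fin 3} (h : ∀ j, t.HasBasis j 0 ↔ j = i) :
    Module.finrank ℂ (t.toSub 0) = 2 := by
  have : t.toSub 0 = ocSub μex 0 ⊔ lineI μex 0 i := by
    refine le_antisymm (t.toSub_le le_sup_left fun j _ hj => ?_)
      (sup_le (t.ocSub_le_toSub 0) ?_)
    · rw [(h j).1 hj]
      exact Submodule.mem_sup_right (Submodule.mem_span_singleton_self _)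
    · exact (Submodule.span_singleton_le_iff_mem _ _).2 (t.basisV_mem_toSub ((h i).2 rfl))
  rw [this, ocSub_sup_lineI nonnegW_zero]
  exact finrank_span_constV_basisV (inCyl_origin i) (inCyl_origin (i + 1)) (by simp)

variable {t}

theorem Good.hasBasis_add (ht : t.Good) {w : W3} {i : Fin 3} (j : Fin 3) (hi : inCyl μex i w)
    (h : t.HasBasis i w) : t.HasBasis i (w + eW j) := by
  obtain ⟨h1, h2, h3, h4, h5, h6⟩ := ht
  have c0 := inCyl_zero_iff w
  have c1 := inCyl_one_iff w
  have c2 := inCyl_two_iff w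
  fin_cases i <;> fin_cases j <;> simp [HasBasis, c0, c1, c2, eW] at * <;> omega

theorem Good.multClosed_toSub (ht : t.Good) : MultClosed μex t.toSub := by
  intro w j
  rw [Submodule.map_le_iff_le_comap]
  refine t.toSub_le ?_ fun i hc hi => ?_
  · rw [← Submodule.map_le_iff_le_comap]
    exact (map_mapV_ocSub_le w j).trans (t.ocSub_le_toSub _)
  · rw [Submodule.mem_comap, mapV_basisV j hc]
    by_cases hc' : inCyl μex i (w + eW j)
    · exact t.basisV_mem_toSub (ht.hasBasis_add j hc hi)
    · rw [basisV_eq_zero hc']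
      exact Submodule.zero_mem _

theorem Good.finrank_toSub_origin (ht : t.Good) :
    Module.finrank ℂ (t.toSub 0) = 1 + t.orig := by
  obtain ⟨h1, h2, h3, h4, h5, h6⟩ := ht
  have ho : t.orig = 0 ∨ t.orig = 1 ∨ t.orig = 2 := by omega
  rcases ho with ho | ho | ho
  · rw [t.toSub_eq_ocSub fun i _ => by fin_cases i <;> simp [HasBasis, ho],
      finrank_ocSub nonnegW_zero (inCyl_origin 0), ho]
  · rw [ho]
    by_cases hX : 0 < t.nX
    · refine t.finrank_toSub_origin_of_unique (i := 0) fun j => ?_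
      fin_cases j <;> simp [HasBasis, ho] <;> omega
    by_cases hY : 0 < t.nY
    · refine t.finrank_toSub_origin_of_unique (i := 1) fun j => ?_
      fin_cases j <;> simp [HasBasis, ho] <;> omega
    · refine t.finrank_toSub_origin_of_unique (i := 2) fun j => ?_
      fin_cases j <;> simp [HasBasis, ho] <;> omega
  · rw [t.finrank_toSub_of_forall fun i _ => by
      fin_cases i <;> simp [HasBasis, ho], numCyl_zero, ho]

theorem Good.finrank_toSub_side (ht : t.Good) :
    Module.finrank ℂ (t.toSub (eW 0)) = 1 + t.side := by
  obtain ⟨h1, h2, h3, h4, h5, h6⟩ := ht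
  have hs : t.side = 0 ∨ t.side = 1 := by omega
  have hB (i : Fin 3) (hi : inCyl μex i (eW 0)) : t.HasBasis i (eW 0) ↔ t.side = 1 := by
    have := not_inCyl_two_side
    fin_cases i
    · simp [HasBasis, eW]
    · simp [HasBasis, eW]
    · exact absurd hi this
  rcases hs with hs | hs
  · rw [t.toSub_eq_ocSub fun i hi => by simp [hB i hi, hs],
      finrank_ocSub (nonnegW_eW 0) inCyl_zero_side, hs]
  · rw [t.finrank_toSub_of_forall fun i hi => (hB i hi).2 hs, numCyl_side, hs]

theorem Good.finrank_toSub (ht : t.Good) (w : W3) :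
    Module.finrank ℂ (t.toSub w) = t.dims w := by
  rcases weight_cases w with rfl | rfl | ⟨k, rfl⟩ | ⟨k, rfl⟩ | ⟨k, rfl⟩ | ⟨k, rfl⟩ | hw
  · rw [ht.finrank_toSub_origin, dims_zero]
  · rw [ht.finrank_toSub_side, dims_side]
  · rw [t.finrank_toSub_of_neg (legX_neg k) (inCyl_legX k), dims_of_neg _ (legX_neg k),
      excess_legX]
    congr 1
    simp [HasBasis, legX]
    omega
  · rw [t.finrank_toSub_of_neg (legY_neg k) (inCyl_legY k), dims_of_neg _ (legY_neg k),
      excess_legY]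
    congr 1
    simp [HasBasis, legY]
    omega
  · rw [t.finrank_toSub_of_neg (legV_neg k) (inCyl_legV k), dims_of_neg _ (legV_neg k),
      excess_legV]
    congr 1
    simp [HasBasis, legV]
    omega
  · rw [t.finrank_toSub_of_neg (legZ_neg k) (inCyl_legZ k), dims_of_neg _ (legZ_neg k),
      excess_legZ]
    congr 1
    simp [HasBasis, legZ]
    omega
  · rw [dims, excess_of_isPlain _ hw, hw.eq_ocSub (t.ocSub_le_toSub w), add_zero]

theorem Good.realizable_dims (ht : t.Good) : Realizable t.dims := by
  refine ⟨t.toSub, ⟨ht.multClosed_toSub, t.ocSub_le_toSub, ?_⟩, ht.finrank_toSub⟩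
  refine t.finite_support_excess.subset fun w hw h0 => hw ?_
  refine (Submodule.eq_of_le_of_finrank_eq (t.ocSub_le_toSub w) ?_).symm
  rw [ht.finrank_toSub, dims, h0, add_zero]

end Config

theorem Cl_eq_image (l : ℕ) : Cl l = Config.dims '' {t | t.Good ∧ t.len = l} := by
  ext D
  constructor
  · rintro ⟨⟨S, hS, hD⟩, hl⟩
    obtain ⟨t, ht, hdims⟩ := exists_good_config hS
    obtain rfl : t.dims = D := funext fun w => (hdims w).symm.trans (hD w)
    exact ⟨t, ⟨ht, t.lenD_dims ▸ hl⟩, rfl⟩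
  · rintro ⟨t, ⟨ht, hl⟩, rfl⟩
    exact ⟨ht.realizable_dims, t.lenD_dims.trans hl⟩

theorem finsum_chi_Cl {l : ℕ} {s : Finset Config} (hs : {t : Config | t.Good ∧ t.len = l} = s) :
    ∑ᶠ D ∈ Cl l, chi D = ∑ t ∈ s, t.euler := by
  rw [Cl_eq_image, finsum_mem_image Config.dims_injective.injOn, hs, finsum_mem_coe_finset]
  exact Finset.sum_congr rfl fun t _ => t.chi_dims

theorem good_len_zero :
    {t : Config | t.Good ∧ t.len = 0} = ({⟨0, 0, 0, 0, 0, 0⟩} : Finset Config) := by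
  ext ⟨o, p, a, b, d, c⟩
  simp [Config.Good, Config.len]
  omega

theorem good_len_one : {t : Config | t.Good ∧ t.len = 1} =
    ({⟨0, 1, 0, 0, 0, 0⟩, ⟨1, 0, 0, 0, 0, 0⟩} : Finset Config) := by
  ext ⟨o, p, a, b, d, c⟩
  simp [Config.Good, Config.len]
  omega

theorem good_len_two : {t : Config | t.Good ∧ t.len = 2} =
    ({⟨1, 1, 0, 0, 0, 0⟩, ⟨0, 1, 0, 0, 1, 0⟩, ⟨1, 0, 0, 0, 0, 1⟩} : Finset Config) := by
  ext ⟨o, p, a, b, d, c⟩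
  simp [Config.Good, Config.len]
  omega

theorem good_len_three : {t : Config | t.Good ∧ t.len = 3} =
    ({⟨2, 1, 0, 0, 0, 0⟩, ⟨1, 1, 1, 0, 0, 0⟩, ⟨1, 1, 0, 0, 1, 0⟩, ⟨1, 1, 0, 0, 0, 1⟩,
      ⟨0, 1, 0, 0, 2, 0⟩, ⟨1, 0, 0, 0, 0, 2⟩} : Finset Config) := by
  ext ⟨o, p, a, b, d, c⟩
  simp only [Config.Good, Config.len, Set.mem_ofPred_eq, Finset.coe_insert, Finset.coe_singleton,
    Set.mem_insert_iff, Set.mem_singleton_iff, Config.mk.injEq]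
  constructor
  · rintro ⟨⟨ho, hp, h⟩, hl⟩
    interval_cases o <;> interval_cases p <;> simp at h ⊢ <;> omega
  · omega

theorem weighted_box_counting_for_1_2_1 :
    (∀ l ≤ 3, (Cl l).Finite) ∧
    (∑ᶠ D ∈ Cl 0, chi D) = 1 ∧
    (∑ᶠ D ∈ Cl 1, chi D) = 2 ∧
    (∑ᶠ D ∈ Cl 2, chi D) = 4 ∧
    (∑ᶠ D ∈ Cl 3, chi D) = 7 := by
  refine ⟨fun l hl => ?_, ?_, ?_, ?_, ?_⟩
  · rw [Cl_eq_image]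
    refine Set.Finite.image _ ?_
    interval_cases l
    · exact good_len_zero ▸ Finset.finite_toSet _
    · exact good_len_one ▸ Finset.finite_toSet _
    · exact good_len_two ▸ Finset.finite_toSet _
    · exact good_len_three ▸ Finset.finite_toSet _
  · rw [finsum_chi_Cl good_len_zero]
    simp [Config.euler]
  · rw [finsum_chi_Cl good_len_one]
    simp [Config.euler]
  · rw [finsum_chi_Cl good_len_two]
    simp [Config.euler]
  · rw [finsum_chi_Cl good_len_three]
    simp [Config.euler]

end
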